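/- Let I_1 ⊆ I_2 ⊆ A and J_1 ⊆ J_2 ⊆ B be monomial ideals, let H = I_1·J_2 + I_2·J_1 ⊆ S be their mixed product, and let γ = (α,β) ∈ ℤ^σ × ℤ^τ. Then Δ_γ(H) = (Δ_σ ∗ Δ_β(J_2)) ∪ (Δ_α(I_1) ∗ Δ_β(J_1)) ∪ (Δ_α(I_2) ∗ Δ_τ), where Δ_σ and Δ_τ are the full simplices on σ and τ; that is, for every subset F of (σ ⊔ τ)∖G_γ, F ∈ Δ_γ(H) if and only if F ∩ τ ∈ Δ_β(J_2), or (F ∩ σ ∈ Δ_α(I_1) and F ∩ τ ∈ Δ_β(J_1)), or F ∩ σ ∈ Δ_α(I_2). -/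

import Mathlib

open MvPolynomial

noncomputable section

variable (k : Type*) [Field k]

/-- The multiplicative submonoid of `S = k[x_i : i ∈ σ]` generated by the variables `x_i, i ∈ F`. -/
def varSubmonoid (σ : Type*) (F : Set σ) : Submonoid (MvPolynomial σ k) :=
  Submonoid.closure ((fun i => (X i : MvPolynomial σ k)) '' F)

/-- The localization `S_F` of `S` at the variables indexed by `F`. -/
abbrev Loc (σ : Type*) (F : Set σ) : Type _ := Localization (varSubmonoid k σ F)

/-- The ideal `I S_F` of `S_F` generated by the image of `I`. -/
def locIdeal {σ : Type*} (I : Ideal (MvPolynomial σ k)) (F : Set σ) : Ideal (Loc k σ F) :=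
  Ideal.map (algebraMap (MvPolynomial σ k) (Loc k σ F)) I

/-- `G_γ = {i | γ i < 0}`. -/
def negSupp {σ : Type*} (γ : σ → ℤ) : Set σ := {i | γ i < 0}

/-- The element `x^γ` of `S_F` (meaningful when `G_γ ⊆ F`):  the image of the monomial with
exponents `max (γ i) 0` multiplied by the inverse of the image of `∏ x_i ^ (-γ i)` over `G_γ`. -/
def xpow {σ : Type*} [Fintype σ] (F : Set σ) (γ : σ → ℤ) : Loc k σ F :=
  algebraMap (MvPolynomial σ k) (Loc k σ F) (∏ i, X i ^ (γ i).toNat) *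
    Ring.inverse (algebraMap (MvPolynomial σ k) (Loc k σ F) (∏ i, X i ^ (-γ i).toNat))

/-- The degree complex `Δ_γ(I)`: all `F ⊆ σ \ G_γ` with `x^γ ∉ I S_{F ∪ G_γ}`. -/
def degCx {σ : Type*} [Fintype σ] (I : Ideal (MvPolynomial σ k)) (γ : σ → ℤ) : Set (Set σ) :=
  {F | F ⊆ (negSupp γ)ᶜ ∧ xpow k (F ∪ negSupp γ) γ ∉ locIdeal k I (F ∪ negSupp γ)}

/-- A monomial ideal is an ideal generated by monomials. -/
def IsMonomialIdeal {σ : Type*} (I : Ideal (MvPolynomial σ k)) : Prop :=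
  ∃ G : Set (σ →₀ ℕ),
    I = Ideal.span ((fun d => (monomial d (1 : k) : MvPolynomial σ k)) '' G)

/-- Extension of an ideal of `A = k[x_i : i ∈ σ]` to `S = k[x_i : i ∈ σ ⊕ τ]` along the
renaming of variables by `Sum.inl`. -/
def extL {σ τ : Type*} (I : Ideal (MvPolynomial σ k)) : Ideal (MvPolynomial (σ ⊕ τ) k) :=
  Ideal.map (rename (Sum.inl : σ → σ ⊕ τ) :
    MvPolynomial σ k →ₐ[k] MvPolynomial (σ ⊕ τ) k).toRingHom I

/-- Extension of an ideal of `B = k[x_i : i ∈ τ]` to `S = k[x_i : i ∈ σ ⊕ τ]` along the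
renaming of variables by `Sum.inr`. -/
def extR {σ τ : Type*} (J : Ideal (MvPolynomial τ k)) : Ideal (MvPolynomial (σ ⊕ τ) k) :=
  Ideal.map (rename (Sum.inr : τ → σ ⊕ τ) :
    MvPolynomial τ k →ₐ[k] MvPolynomial (σ ⊕ τ) k).toRingHom J

/-- The maximal homogeneous ideal, generated by all the variables. -/
def maxIdeal (σ : Type*) : Ideal (MvPolynomial σ k) :=
  Ideal.span (Set.range (X : σ → MvPolynomial σ k))

/-- A product of variables in `F` is a monomial supported in `F`, and conversely. -/
lemma mem_varSubmonoid_iff {σ : Type*} {F : Set σ} {m : MvPolynomial σ k} :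
    m ∈ varSubmonoid k σ F ↔ ∃ e : σ →₀ ℕ, (∀ i ∉ F, e i = 0) ∧ m = monomial e 1 := by
  constructor
  · intro hm
    induction hm using Submonoid.closure_induction with
    | mem x hx =>
      obtain ⟨i, hi, rfl⟩ := hx
      refine ⟨Finsupp.single i 1, fun j hj => ?_, rfl⟩
      exact Finsupp.single_eq_of_ne (fun h => hj (h ▸ hi))
    | one => exact ⟨0, fun _ _ => rfl, rfl⟩
    | mul x y _ _ hx hy =>
      obtain ⟨e, he, rfl⟩ := hx
      obtain ⟨f, hf, rfl⟩ := hy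
      exact ⟨e + f, fun i hi => by simp [he i hi, hf i hi], by simp [monomial_mul]⟩
  · rintro ⟨e, he, rfl⟩
    rw [monomial_eq, C_1, one_mul]
    refine Submonoid.prod_mem _ fun i hi => Submonoid.pow_mem _ (Submonoid.subset_closure ?_) _
    exact ⟨i, by_contra fun h => Finsupp.mem_support_iff.mp hi (he i h), rfl⟩

lemma prod_X_pow_eq_monomial_equivFunOnFinite {σ : Type*} [Fintype σ] (f : σ → ℕ) :
    (∏ i, X i ^ f i : MvPolynomial σ k) = monomial (Finsupp.equivFunOnFinite.symm f) 1 := by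
  rw [monomial_eq, C_1, one_mul, Finsupp.prod_fintype _ _ fun _ => pow_zero _]
  rfl

/-- Membership of `x^γ` in the localization of a monomial ideal, read off from the exponents of
the generators. -/
lemma xpow_mem_locIdeal_span_iff {σ : Type*} [Fintype σ] (G : Set (σ →₀ ℕ)) (F : Set σ)
    (γ : σ → ℤ) (hF : negSupp γ ⊆ F) :
    xpow k F γ ∈ locIdeal k (Ideal.span
        ((fun d => (monomial d (1 : k) : MvPolynomial σ k)) '' G)) F ↔
      ∃ d ∈ G, ∀ i ∉ F, (d i : ℤ) ≤ γ i := by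
  classical
  have hnonneg : ∀ i ∉ F, 0 ≤ γ i := fun i hi => not_lt.mp fun h => hi (hF h)
  have hden : (∏ i, X i ^ (-γ i).toNat : MvPolynomial σ k) ∈ varSubmonoid k σ F := by
    rw [prod_X_pow_eq_monomial_equivFunOnFinite, mem_varSubmonoid_iff]
    refine ⟨_, fun i hi => ?_, rfl⟩
    have := hnonneg i hi
    simp only [Finsupp.equivFunOnFinite_symm_apply_apply]
    omega
  have hunit := IsLocalization.map_units (Loc k σ F) ⟨_, hden⟩
  rw [xpow, locIdeal, Ideal.mul_unit_mem_iff_mem _ hunit.ringInverse,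
    IsLocalization.algebraMap_mem_map_algebraMap_iff (varSubmonoid k σ F),
    prod_X_pow_eq_monomial_equivFunOnFinite]
  constructor
  · rintro ⟨m, hm, h⟩
    obtain ⟨e, he, rfl⟩ := (mem_varSubmonoid_iff k).mp hm
    rw [monomial_mul, one_mul, mem_ideal_span_monomial_image] at h
    obtain ⟨d, hd, hle⟩ := h (e + Finsupp.equivFunOnFinite.symm fun i => (γ i).toNat)
      (by rw [mem_support_iff, coeff_monomial, if_pos rfl]; exact one_ne_zero)
    refine ⟨d, hd, fun i hi => ?_⟩
    have h₁ := hle i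
    have h₂ := hnonneg i hi
    simp only [Finsupp.add_apply, he i hi, Finsupp.equivFunOnFinite_symm_apply_apply] at h₁
    omega
  · rintro ⟨d, hd, hle⟩
    refine ⟨_, (mem_varSubmonoid_iff k).mpr ⟨d.filter (· ∈ F), fun i hi => ?_, rfl⟩, ?_⟩
    · exact Finsupp.filter_apply_neg _ _ hi
    · rw [monomial_mul, one_mul, mem_ideal_span_monomial_image]
      intro x hx
      have hx' := Finset.mem_singleton.mp (support_monomial_subset hx)
      refine ⟨d, hd, hx' ▸ fun i => ?_⟩
      by_cases hi : i ∈ F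
      · simp [hi]
      · have := hle i hi
        simp only [Finsupp.add_apply, Finsupp.filter_apply, hi, if_false,
          Finsupp.equivFunOnFinite_symm_apply_apply]
        omega

/-- The product of extensions of monomial ideals in disjoint variables is generated by the products
of the generators. -/
lemma extL_span_mul_extR_span {σ τ : Type*} (G : Set (σ →₀ ℕ)) (K : Set (τ →₀ ℕ)) :
    extL k (τ := τ) (Ideal.span ((fun d => (monomial d (1 : k) : MvPolynomial σ k)) '' G)) *
        extR k (σ := σ) (Ideal.span ((fun d => (monomial d (1 : k) : MvPolynomial τ k)) '' K)) =
      Ideal.span ((fun d => (monomial d (1 : k) : MvPolynomial (σ ⊕ τ) k)) ''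
        Set.image2 (fun d e => d.mapDomain Sum.inl + e.mapDomain Sum.inr) G K) := by
  rw [extL, extR, Ideal.map_span, Ideal.map_span, Ideal.span_mul_span', ← Set.image2_mul,
    Set.image_image, Set.image_image, Set.image2_image_left, Set.image2_image_right,
    Set.image_image2]
  congr 1
  refine Set.image2_congr fun d _ e _ => ?_
  simp [rename_monomial, monomial_mul]

lemma mapDomain_inl_add_mapDomain_inr_le_iff {σ τ : Type*} (d : σ →₀ ℕ) (e : τ →₀ ℕ)
    (F : Set (σ ⊕ τ)) (α : σ → ℤ) (β : τ → ℤ) :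
    (∀ i ∉ F, ((d.mapDomain Sum.inl + e.mapDomain Sum.inr : σ ⊕ τ →₀ ℕ) i : ℤ) ≤
        Sum.elim α β i) ↔
      (∀ i ∉ Sum.inl ⁻¹' F, (d i : ℤ) ≤ α i) ∧ ∀ j ∉ Sum.inr ⁻¹' F, (e j : ℤ) ≤ β j := by
  have hl (i : σ) : (d.mapDomain Sum.inl + e.mapDomain Sum.inr : σ ⊕ τ →₀ ℕ) (Sum.inl i) = d i := by
    rw [Finsupp.add_apply, Finsupp.mapDomain_apply Sum.inl_injective,
      Finsupp.mapDomain_of_notMem_range _ _ (by simp), add_zero]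
  have hr (j : τ) : (d.mapDomain Sum.inl + e.mapDomain Sum.inr : σ ⊕ τ →₀ ℕ) (Sum.inr j) = e j := by
    rw [Finsupp.add_apply, Finsupp.mapDomain_apply Sum.inr_injective,
      Finsupp.mapDomain_of_notMem_range _ _ (by simp), zero_add]
  simp only [Sum.forall, hl, hr, Sum.elim_inl, Sum.elim_inr, Set.mem_preimage]

/-- for monomial ideals `I₁ ⊆ I₂ ⊆ A` and `J₁ ⊆ J₂ ⊆ B` with mixed product
`H = I₁·J₂ + I₂·J₁ ⊆ S`, and `γ = (α, β)`:
`Δ_γ(H) = (Δ_σ ∗ Δ_β(J₂)) ∪ (Δ_α(I₁) ∗ Δ_β(J₁)) ∪ (Δ_α(I₂) ∗ Δ_τ)`, i.e. for every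
`F ⊆ (σ ⊔ τ) \ G_γ`, `F ∈ Δ_γ(H)` iff `F ∩ τ ∈ Δ_β(J₂)`, or
(`F ∩ σ ∈ Δ_α(I₁)` and `F ∩ τ ∈ Δ_β(J₁)`), or `F ∩ σ ∈ Δ_α(I₂)`. -/
theorem statement19 {σ τ : Type*} [Fintype σ] [Fintype τ]
    (I₁ I₂ : Ideal (MvPolynomial σ k)) (J₁ J₂ : Ideal (MvPolynomial τ k))
    (hI₁ : IsMonomialIdeal k I₁) (hI₂ : IsMonomialIdeal k I₂)
    (hJ₁ : IsMonomialIdeal k J₁) (hJ₂ : IsMonomialIdeal k J₂)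
    (hI : I₁ ≤ I₂) (hJ : J₁ ≤ J₂) (α : σ → ℤ) (β : τ → ℤ) :
    ∀ F : Set (σ ⊕ τ), F ⊆ (negSupp (Sum.elim α β))ᶜ →
      (F ∈ degCx k (extL k I₁ * extR k J₂ + extL k I₂ * extR k J₁) (Sum.elim α β) ↔
        Sum.inr ⁻¹' F ∈ degCx k J₂ β ∨
          (Sum.inl ⁻¹' F ∈ degCx k I₁ α ∧ Sum.inr ⁻¹' F ∈ degCx k J₁ β) ∨
          Sum.inl ⁻¹' F ∈ degCx k I₂ α) := by
  intro F hF
  have mono_α : xpow k (Sum.inl ⁻¹' F ∪ negSupp α) α ∈ locIdeal k I₁ (Sum.inl ⁻¹' F ∪ negSupp α) →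
      xpow k (Sum.inl ⁻¹' F ∪ negSupp α) α ∈ locIdeal k I₂ (Sum.inl ⁻¹' F ∪ negSupp α) :=
    fun h => Ideal.map_mono hI h
  have mono_β : xpow k (Sum.inr ⁻¹' F ∪ negSupp β) β ∈ locIdeal k J₁ (Sum.inr ⁻¹' F ∪ negSupp β) →
      xpow k (Sum.inr ⁻¹' F ∪ negSupp β) β ∈ locIdeal k J₂ (Sum.inr ⁻¹' F ∪ negSupp β) :=
    fun h => Ideal.map_mono hJ h
  have hFα : Sum.inl ⁻¹' F ⊆ (negSupp α)ᶜ := fun i hi => hF hi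
  have hFβ : Sum.inr ⁻¹' F ⊆ (negSupp β)ᶜ := fun j hj => hF hj
  have hl : Sum.inl ⁻¹' (F ∪ negSupp (Sum.elim α β)) = Sum.inl ⁻¹' F ∪ negSupp α := rfl
  have hr : Sum.inr ⁻¹' (F ∪ negSupp (Sum.elim α β)) = Sum.inr ⁻¹' F ∪ negSupp β := rfl
  have key : xpow k (F ∪ negSupp (Sum.elim α β)) (Sum.elim α β) ∈
      locIdeal k (extL k I₁ * extR k J₂ + extL k I₂ * extR k J₁) (F ∪ negSupp (Sum.elim α β)) ↔
      (xpow k (Sum.inl ⁻¹' F ∪ negSupp α) α ∈ locIdeal k I₁ (Sum.inl ⁻¹' F ∪ negSupp α) ∧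
        xpow k (Sum.inr ⁻¹' F ∪ negSupp β) β ∈ locIdeal k J₂ (Sum.inr ⁻¹' F ∪ negSupp β)) ∨
      (xpow k (Sum.inl ⁻¹' F ∪ negSupp α) α ∈ locIdeal k I₂ (Sum.inl ⁻¹' F ∪ negSupp α) ∧
        xpow k (Sum.inr ⁻¹' F ∪ negSupp β) β ∈ locIdeal k J₁ (Sum.inr ⁻¹' F ∪ negSupp β)) := by
    clear mono_α mono_β hI hJ
    obtain ⟨G₁, rfl⟩ := hI₁
    obtain ⟨G₂, rfl⟩ := hI₂
    obtain ⟨K₁, rfl⟩ := hJ₁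
    obtain ⟨K₂, rfl⟩ := hJ₂
    rw [extL_span_mul_extR_span, extL_span_mul_extR_span, Submodule.add_eq_sup,
      ← Ideal.span_union, ← Set.image_union]
    iterate 5 rw [xpow_mem_locIdeal_span_iff _ _ _ _ Set.subset_union_right]
    simp only [Set.mem_union (α := σ ⊕ τ →₀ ℕ), or_and_right, exists_or]
    simp only [Set.exists_mem_image2, mapDomain_inl_add_mapDomain_inr_le_iff, hl, hr]
    refine or_congr ?_ ?_ <;>
      exact ⟨fun ⟨d, hd, e, he, h, h'⟩ => ⟨⟨d, hd, h⟩, e, he, h'⟩,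
        fun ⟨⟨d, hd, h⟩, e, he, h'⟩ => ⟨d, hd, e, he, h, h'⟩⟩
  simp only [degCx, Set.mem_ofPred_eq, key, hF, hFα, hFβ, true_and]
  tauto
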